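/- Let D be a digraph with a vertex u of total degree d(u) = d⁺(u) + d⁻(u) ≥ 2. Then for α ∈ [0,1), ‖A_α(D)‖_* ≤ ‖A_α(D − u)‖_* + d(u)·√(2α² − 2α + 1). -/

import Mathlib

open Matrix BigOperators

/-- Trace norm: sum of singular values (square roots of eigenvalues of `M * Mᴴ`). -/
noncomputable def traceNorm {m : Type*} [Fintype m] [DecidableEq m]
    (M : Matrix m m ℝ) : ℝ :=
  ∑ i, Real.sqrt ((Matrix.isHermitian_mul_conjTranspose_self M).eigenvalues i)

/-- Outdegree of a vertex in a digraph. -/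
def outDeg {V : Type*} [Fintype V] (G : Digraph V) [DecidableRel G.Adj] (u : V) : ℕ :=
  (Finset.univ.filter (fun w => G.Adj u w)).card

/-- Indegree of a vertex in a digraph. -/
def inDeg {V : Type*} [Fintype V] (G : Digraph V) [DecidableRel G.Adj] (u : V) : ℕ :=
  (Finset.univ.filter (fun w => G.Adj w u)).card

/-- The `A_α` matrix of a digraph: `α Δ⁺ + (1-α) A`. -/
noncomputable def Aalpha {V : Type*} [Fintype V] [DecidableEq V] (α : ℝ)
    (G : Digraph V) [DecidableRel G.Adj] : Matrix V V ℝ :=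
  α • Matrix.diagonal (fun v => (outDeg G v : ℝ)) +
    (1 - α) • Matrix.of (fun i j => if G.Adj i j then (1 : ℝ) else 0)

/-- Deleting the arc `uv` from a digraph. -/
def delArc {V : Type*} [DecidableEq V] (G : Digraph V) (u v : V) : Digraph V :=
  ⟨fun i j => G.Adj i j ∧ ¬(i = u ∧ j = v)⟩

instance {V : Type*} [DecidableEq V] (G : Digraph V) [DecidableRel G.Adj] (u v : V) :
    DecidableRel (delArc G u v).Adj :=
  fun i j => inferInstanceAs (Decidable (G.Adj i j ∧ ¬(i = u ∧ j = v)))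

/-- Deleting a vertex `u` (and all incident arcs) from a digraph. -/
def delVertex {V : Type*} (G : Digraph V) (u : V) : Digraph {w : V // w ≠ u} :=
  ⟨fun i j => G.Adj i j⟩

instance {V : Type*} (G : Digraph V) [DecidableRel G.Adj] (u : V) :
    DecidableRel (delVertex G u).Adj :=
  fun i j => inferInstanceAs (Decidable (G.Adj i j))

/-- A matrix is a row contraction if `x ↦ x ᵥ* K` does not increase the Euclidean norm. -/
def IsRowContraction {m : Type*} [Fintype m] (K : Matrix m m ℝ) : Prop :=
  ∀ x : m → ℝ, (x ᵥ* K) ⬝ᵥ (x ᵥ* K) ≤ x ⬝ᵥ x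

theorem vecMul_dotProduct_vecMul_self {m n : Type*} [Fintype m] [Fintype n] (x : m → ℝ)
    (N : Matrix m n ℝ) : (x ᵥ* N) ⬝ᵥ (x ᵥ* N) = (x ᵥ* (N * Nᵀ)) ⬝ᵥ x := by
  rw [← vecMul_vecMul, vecMul_transpose, dotProduct_comm _ x, dotProduct_mulVec]

/-- Diagonalization of `M * Mᴴ` by an orthogonal matrix, expressed through the rows of `Uᵀ * M`. -/
theorem exists_orthogonal_mul_transpose_eq_diagonal {m : Type*} [Fintype m] [DecidableEq m]
    (M : Matrix m m ℝ) :
    ∃ U : Matrix m m ℝ, Uᵀ * U = 1 ∧ U * Uᵀ = 1 ∧ (Uᵀ * M) * (Uᵀ * M)ᵀ =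
      diagonal (Matrix.isHermitian_mul_conjTranspose_self M).eigenvalues := by
  set h := Matrix.isHermitian_mul_conjTranspose_self M
  have h1 : (h.eigenvectorUnitary : Matrix m m ℝ)ᵀ * h.eigenvectorUnitary = 1 := by
    have := Unitary.coe_star_mul_self h.eigenvectorUnitary
    rwa [star_eq_conjTranspose, conjTranspose_eq_transpose_of_trivial] at this
  have h2 : (h.eigenvectorUnitary : Matrix m m ℝ) * (h.eigenvectorUnitary : Matrix m m ℝ)ᵀ = 1 :=
    mul_eq_one_comm.mp h1
  refine ⟨(h.eigenvectorUnitary : Matrix m m ℝ), h1, h2, ?_⟩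
  have hs : M * Mᵀ = (h.eigenvectorUnitary : Matrix m m ℝ) * diagonal h.eigenvalues *
      (h.eigenvectorUnitary : Matrix m m ℝ)ᵀ := by
    have := h.spectral_theorem
    rw [Unitary.conjStarAlgAut_apply, star_eq_conjTranspose,
      conjTranspose_eq_transpose_of_trivial (h.eigenvectorUnitary : Matrix m m ℝ)] at this
    rw [← conjTranspose_eq_transpose_of_trivial M]
    exact this
  generalize (h.eigenvectorUnitary : Matrix m m ℝ) = U at *
  calc (Uᵀ * M) * (Uᵀ * M)ᵀ = Uᵀ * (M * Mᵀ) * U := by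
        simp only [transpose_mul, transpose_transpose, Matrix.mul_assoc]
    _ = (Uᵀ * U) * diagonal h.eigenvalues * (Uᵀ * U) := by
        rw [hs]
        simp only [Matrix.mul_assoc]
    _ = diagonal h.eigenvalues := by rw [h1, Matrix.one_mul, Matrix.mul_one]

theorem IsRowContraction.trace_mul_transpose_le_traceNorm {m : Type*} [Fintype m] [DecidableEq m]
    {Q : Matrix m m ℝ} (hQ : IsRowContraction Q) (M : Matrix m m ℝ) :
    (Q * Mᵀ).trace ≤ traceNorm M := by
  obtain ⟨U, h1, h2, h3⟩ := exists_orthogonal_mul_transpose_eq_diagonal M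
  have key : (Q * Mᵀ).trace = ((Uᵀ * Q) * (Uᵀ * M)ᵀ).trace := by
    rw [transpose_mul, transpose_transpose, Matrix.mul_assoc, trace_mul_comm Uᵀ,
      Matrix.mul_assoc, Matrix.mul_assoc, h2, Matrix.mul_one]
  rw [key, traceNorm, trace]
  refine Finset.sum_le_sum fun i _ => Real.le_sqrt_of_sq_le ?_
  have hM : ∑ j, (Uᵀ * M) i j ^ 2 =
      (Matrix.isHermitian_mul_conjTranspose_self M).eigenvalues i := by
    have := congrFun (congrFun h3 i) i
    rw [diagonal_apply_eq, mul_apply] at this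
    rw [← this]
    exact Finset.sum_congr rfl fun j _ => sq _
  have hU : ∑ j, (Uᵀ * Q) i j ^ 2 ≤ 1 := by
    have h4 := hQ (Uᵀ i)
    have h5 : Uᵀ i ⬝ᵥ Uᵀ i = 1 := by
      have := congrFun (congrFun h1 i) i
      rwa [one_apply_eq] at this
    rw [h5] at h4
    refine le_trans (le_of_eq (Finset.sum_congr rfl fun j _ => ?_)) h4
    exact sq _
  calc ((Uᵀ * Q * (Uᵀ * M)ᵀ).diag i) ^ 2
      = (∑ j, (Uᵀ * Q) i j * (Uᵀ * M) i j) ^ 2 := rfl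
    _ ≤ (∑ j, (Uᵀ * Q) i j ^ 2) * ∑ j, (Uᵀ * M) i j ^ 2 := Finset.sum_mul_sq_le_sq_mul_sq _ _ _
    _ ≤ 1 * ∑ j, (Uᵀ * M) i j ^ 2 := by gcongr
    _ = _ := by rw [one_mul, hM]

theorem exists_isRowContraction_trace_mul_transpose_eq_traceNorm {m : Type*} [Fintype m]
    [DecidableEq m] (M : Matrix m m ℝ) :
    ∃ Q : Matrix m m ℝ, IsRowContraction Q ∧ (Q * Mᵀ).trace = traceNorm M := by
  obtain ⟨U, h1, h2, h3⟩ := exists_orthogonal_mul_transpose_eq_diagonal M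
  have hpos : ∀ i, 0 ≤ (Matrix.isHermitian_mul_conjTranspose_self M).eigenvalues i :=
    (Matrix.posSemidef_self_mul_conjTranspose M).eigenvalues_nonneg
  rw [traceNorm]
  set l := (Matrix.isHermitian_mul_conjTranspose_self M).eigenvalues
  refine ⟨U * (diagonal (fun i => (√(l i))⁻¹) * (Uᵀ * M)), fun x => ?_, ?_⟩
  · have hx : (x ᵥ* U) ⬝ᵥ (x ᵥ* U) = x ⬝ᵥ x := by
      rw [vecMul_dotProduct_vecMul_self, h2, vecMul_one]
    rw [← vecMul_vecMul, ← vecMul_vecMul, ← hx]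
    generalize x ᵥ* U = z
    rw [vecMul_dotProduct_vecMul_self, h3]
    refine Finset.sum_le_sum fun i _ => ?_
    rw [vecMul_diagonal, vecMul_diagonal]
    calc z i * (√(l i))⁻¹ * l i * (z i * (√(l i))⁻¹)
        = z i * z i * (l i * ((√(l i))⁻¹ * (√(l i))⁻¹)) := by ring
      _ = z i * z i * (l i * (l i)⁻¹) := by rw [← mul_inv, Real.mul_self_sqrt (hpos i)]
      _ ≤ z i * z i := mul_le_of_le_one_right (mul_self_nonneg _) mul_inv_le_one
  · have h4 : (U * (diagonal (fun i => (√(l i))⁻¹) * (Uᵀ * M)) * Mᵀ).trace =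
        (diagonal (fun i => (√(l i))⁻¹) * ((Uᵀ * M) * (Uᵀ * M)ᵀ)).trace := by
      rw [Matrix.mul_assoc, trace_mul_comm, transpose_mul, transpose_transpose]
      simp only [Matrix.mul_assoc]
    rw [h4, h3, diagonal_mul_diagonal, trace_diagonal]
    refine Finset.sum_congr rfl fun i _ => ?_
    rw [inv_mul_eq_div, Real.div_sqrt]

theorem IsRowContraction.submatrix_val {m : Type*} [Fintype m] {Q : Matrix m m ℝ}
    (hQ : IsRowContraction Q) (p : m → Prop) [DecidablePred p] :
    IsRowContraction (Q.submatrix (Subtype.val : {i // p i} → m) Subtype.val) := by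
  intro x
  set y : m → ℝ := fun i => if hi : p i then x ⟨i, hi⟩ else 0
  have hsum (g : m → ℝ) : ∑ i, y i * g i = ∑ i : {i // p i}, x i * g i := by
    rw [← Fintype.sum_subtype_add_sum_subtype p, add_eq_left.mpr]
    · exact Finset.sum_congr rfl fun i _ => by simp [y, i.2]
    · exact Finset.sum_eq_zero fun i _ => by simp [y, i.2]
  have hy : y ⬝ᵥ y = x ⬝ᵥ x :=
    (hsum y).trans (Finset.sum_congr rfl fun i _ => by simp [y, i.2])
  have hv (j : {i // p i}) :
      (x ᵥ* Q.submatrix (Subtype.val : {i // p i} → m) Subtype.val) j = (y ᵥ* Q) j :=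
    (hsum fun i => Q i j).symm
  rw [← hy]
  refine le_trans ?_ (hQ y)
  simp only [dotProduct, hv]
  rw [← Fintype.sum_subtype_add_sum_subtype p (fun j => (y ᵥ* Q) j * (y ᵥ* Q) j)]
  exact le_add_of_nonneg_right (Finset.sum_nonneg fun j _ => mul_self_nonneg _)

theorem IsRowContraction.sum_sq_le_one {m : Type*} [Fintype m] [DecidableEq m]
    {Q : Matrix m m ℝ} (hQ : IsRowContraction Q) (i : m) : ∑ j, Q i j ^ 2 ≤ 1 := by
  have h := hQ (Pi.single i 1)
  rw [single_one_vecMul, single_one_dotProduct, Pi.single_eq_same] at h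
  simpa [dotProduct, ← sq] using h

theorem trace_mul_transpose_Aalpha {V : Type*} [Fintype V] [DecidableEq V] (α : ℝ)
    (G : Digraph V) [DecidableRel G.Adj] (Q : Matrix V V ℝ) :
    (Q * (Aalpha α G)ᵀ).trace =
      ∑ i, ∑ j, if G.Adj i j then α * Q i i + (1 - α) * Q i j else 0 := by
  rw [trace]
  refine Finset.sum_congr rfl fun i _ => ?_
  rw [← Finset.sum_filter, Finset.sum_add_distrib, Finset.sum_const, ← Finset.mul_sum,
    Finset.sum_filter]
  simp only [diag_apply, mul_apply, transpose_apply, Aalpha, Matrix.add_apply, Matrix.smul_apply,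
    smul_eq_mul, of_apply, mul_add, Finset.sum_add_distrib, diagonal_apply, nsmul_eq_mul]
  congr 1
  · simp [outDeg]
    ring
  · simp [Finset.mul_sum, mul_comm]

theorem traceNorm_delVertex_le {V : Type*} [Fintype V] [DecidableEq V]
    (α : ℝ) (hα : α ∈ Set.Ico (0:ℝ) 1)
    (G : Digraph V) [DecidableRel G.Adj] (u : V)
    (hd : 2 ≤ outDeg G u + inDeg G u) :
    traceNorm (Aalpha α G) ≤
      traceNorm (Aalpha α (delVertex G u)) +
        ((outDeg G u + inDeg G u : ℕ) : ℝ) * Real.sqrt (2 * α ^ 2 - 2 * α + 1) := by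
  obtain ⟨Q, hQ, hQA⟩ := exists_isRowContraction_trace_mul_transpose_eq_traceNorm (Aalpha α G)
  have hsub := (hQ.submatrix_val (· ≠ u)).trace_mul_transpose_le_traceNorm
    (Aalpha α (delVertex G u))
  rw [trace_mul_transpose_Aalpha] at hsub hQA
  rw [← hQA]
  set s := √(2 * α ^ 2 - 2 * α + 1)
  set f : V → V → ℝ := fun i j => if G.Adj i j then α * Q i i + (1 - α) * Q i j else 0
  set a : V → V → ℝ := fun i j => if G.Adj i j then 1 else 0
  have hf : ∀ i j, i ≠ j → f i j ≤ a i j * s := by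
    intro i j hij
    simp only [f, a]
    split_ifs
    · rw [one_mul]
      refine Real.le_sqrt_of_sq_le ?_
      have h1 : Q i i ^ 2 + Q i j ^ 2 ≤ 1 := by
        rw [← Finset.sum_pair (f := fun k => Q i k ^ 2) hij]
        exact (Finset.sum_le_univ_sum_of_nonneg fun k => sq_nonneg _).trans (hQ.sum_sq_le_one i)
      nlinarith [sq_nonneg (α * Q i j - (1 - α) * Q i i),
        mul_le_mul_of_nonneg_left h1 (add_nonneg (sq_nonneg α) (sq_nonneg (1 - α)))]
    · simp
  have hfu : f u u ≤ 2 * (a u u * s) := by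
    simp only [f, a]
    split_ifs
    · have h1 : Q u u ^ 2 ≤ 1 :=
        (Finset.single_le_sum (f := fun k => Q u k ^ 2) (fun k _ => sq_nonneg _)
          (Finset.mem_univ u)).trans (hQ.sum_sq_le_one u)
      have h2 : 1 / 2 ≤ s := Real.le_sqrt_of_sq_le (by nlinarith [sq_nonneg (2 * α - 1)])
      nlinarith
    · simp
  have hout : (outDeg G u : ℝ) = a u u + ∑ j : {w // w ≠ u}, a u j := by
    rw [← Fintype.sum_eq_add_sum_subtype_ne (fun j => a u j)]
    simp [outDeg, a]
  have hin : (inDeg G u : ℝ) = a u u + ∑ i : {w // w ≠ u}, a i u := by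
    rw [← Fintype.sum_eq_add_sum_subtype_ne (fun i => a i u)]
    simp [inDeg, a]
  have hsplit : ∑ i, ∑ j, f i j = ∑ i : {w // w ≠ u}, ∑ j : {w // w ≠ u}, f i j + f u u +
      ∑ j : {w // w ≠ u}, f u j + ∑ i : {w // w ≠ u}, f i u := by
    rw [Fintype.sum_eq_add_sum_subtype_ne _ u, Fintype.sum_eq_add_sum_subtype_ne (f u) u]
    simp only [fun i => Fintype.sum_eq_add_sum_subtype_ne (f i) u, Finset.sum_add_distrib]
    ring
  have h1 : ∑ j : {w // w ≠ u}, f u j ≤ (∑ j : {w // w ≠ u}, a u j) * s := by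
    rw [Finset.sum_mul]
    exact Finset.sum_le_sum fun j _ => hf _ _ j.2.symm
  have h2 : ∑ i : {w // w ≠ u}, f i u ≤ (∑ i : {w // w ≠ u}, a i u) * s := by
    rw [Finset.sum_mul]
    exact Finset.sum_le_sum fun i _ => hf _ _ i.2
  have h3 : ∑ i : {w // w ≠ u}, ∑ j : {w // w ≠ u}, f i j ≤
      traceNorm (Aalpha α (delVertex G u)) := hsub
  rw [hsplit]
  push_cast
  rw [hout, hin]
  linarith
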